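/- arXiv:2411.01481 — 3 statements merged into one kernel-verified Lean document; each statement's English description precedes it below -/
import Mathlib

section
/- Let A be a q×n complex matrix, W a nonzero n×q complex matrix, m a positive integer, and define the W-weighted m-weak group MP inverse A^{Ⓦ_m,W,†} = W·A^{Ⓦ_m,W}·W·A·A^†. Then A^{Ⓦ_m,W,†} is an outer inverse of A, that is, A^{Ⓦ_m,W,†}·A·A^{Ⓦ_m,W,†} = A^{Ⓦ_m,W,†}. -/
open Matrix

/-- Index of a square matrix: least `d` with `rank (B^d) = rank (B^(d+1))`. -/
noncomputable def matInd {ι : Type*} [Fintype ι] [DecidableEq ι] (B : Matrix ι ι ℂ) : ℕ :=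
  sInf {d : ℕ | (B ^ d).rank = (B ^ (d + 1)).rank}

/-- `X` is the Moore-Penrose inverse of `A` (four Penrose equations). -/
noncomputable def IsMP {ι κ : Type*} [Fintype ι] [Fintype κ] (A : Matrix ι κ ℂ) (X : Matrix κ ι ℂ) : Prop :=
  A * X * A = A ∧ X * A * X = X ∧ (A * X)ᴴ = A * X ∧ (X * A)ᴴ = X * A

/-- Column space (range) of a matrix. -/
noncomputable def mrange {ι κ : Type*} [Fintype κ] (M : Matrix ι κ ℂ) : Submodule ℂ (ι → ℂ) :=
  LinearMap.range M.mulVecLin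

/-- Null space of a matrix. -/
noncomputable def mker {ι κ : Type*} [Fintype κ] (M : Matrix ι κ ℂ) : Submodule ℂ (κ → ℂ) :=
  LinearMap.ker M.mulVecLin

/-- `X` is the core-EP inverse of `B`. -/
noncomputable def IsCoreEP {ι : Type*} [Fintype ι] [DecidableEq ι] (B X : Matrix ι ι ℂ) : Prop :=
  X * B * X = X ∧ mrange X = mrange (B ^ matInd B) ∧ mrange Xᴴ = mrange (B ^ matInd B)

/-- `X` is the Drazin inverse of `B`. -/
noncomputable def IsDrazin {ι : Type*} [Fintype ι] [DecidableEq ι] (B X : Matrix ι ι ℂ) : Prop :=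
  X * B * X = X ∧ B * X = X * B ∧ B ^ (matInd B + 1) * X = B ^ matInd B

/-- `X` is the group inverse of `B`. -/
noncomputable def IsGroupInv {ι : Type*} [Fintype ι] (B X : Matrix ι ι ℂ) : Prop :=
  B * X * B = B ∧ X * B * X = X ∧ B * X = X * B

/-- Frobenius norm of a matrix. -/
noncomputable def frobNorm {ι κ : Type*} [Fintype ι] [Fintype κ] (M : Matrix ι κ ℂ) : ℝ :=
  Real.sqrt (∑ i, ∑ j, ‖M i j‖ ^ 2)

theorem exists_eq_mul_of_mrange_le {ι κ l : Type*} [Fintype κ] [Fintype l] [DecidableEq l]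
    {M : Matrix ι l ℂ} {N : Matrix ι κ ℂ} (h : mrange M ≤ mrange N) :
    ∃ Z : Matrix κ l ℂ, M = N * Z := by
  have hcol (j : l) : ∃ z : κ → ℂ, N *ᵥ z = M.col j :=
    h ⟨Pi.single j 1, by simp⟩
  choose z hz using hcol
  refine ⟨Matrix.of fun i j => z j i, ?_⟩
  ext i j
  exact (congrFun (hz j) i).symm

theorem mrange_mul_le {ι κ l : Type*} [Fintype κ] [Fintype l]
    (M : Matrix ι κ ℂ) (N : Matrix κ l ℂ) : mrange (M * N) ≤ mrange M := by
  unfold mrange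
  rw [Matrix.mulVecLin_mul]
  exact LinearMap.range_comp_le_range _ _

theorem IsCoreEP.mul_mul_self {ι : Type*} [Fintype ι] [DecidableEq ι]
    {B X : Matrix ι ι ℂ} (h : IsCoreEP B X) : B * X * X = X := by
  obtain ⟨hX, hr, -⟩ := h
  set k := matInd B
  obtain ⟨Y, hY⟩ := exists_eq_mul_of_mrange_le hr.le
  obtain ⟨V, hV⟩ := exists_eq_mul_of_mrange_le hr.ge
  have hXB : X * (B ^ k * B) = B ^ k := by
    rw [← pow_succ, pow_succ', ← Matrix.mul_assoc, hV, ← Matrix.mul_assoc, hX]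
  have hrank : (B ^ k).rank ≤ (B ^ k * B).rank := by
    conv_lhs => rw [← hXB]
    exact Matrix.rank_mul_le_right _ _
  have hrange : mrange (B ^ k * B) = mrange (B ^ k) :=
    Submodule.eq_of_le_of_finrank_le (mrange_mul_le _ _) hrank
  obtain ⟨Z, hZ⟩ := exists_eq_mul_of_mrange_le hrange.ge
  have hBX : B * X * B ^ k = B ^ k := by
    conv_lhs => rw [hZ]
    rw [Matrix.mul_assoc, ← Matrix.mul_assoc X, hXB, ← Matrix.mul_assoc, ← pow_succ', pow_succ,
      ← hZ]
  calc B * X * X = B * X * (B ^ k * Y) := by rw [← hY]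
    _ = X := by rw [← Matrix.mul_assoc, hBX, ← hY]

theorem pow_mul_pow_eq_mul {R : Type*} [Monoid R] {b x : R} (h : b * x * x = x) (m : ℕ) :
    b ^ (m + 1) * x ^ (m + 1) = b * x := by
  induction m with
  | zero => simp
  | succ m ih =>
    calc b ^ (m + 2) * x ^ (m + 2) = b ^ (m + 1) * (b * x * x) * x ^ m := by
          simp only [pow_succ b (m + 1), pow_succ' x, mul_assoc]
      _ = b * x := by rw [h, mul_assoc, ← pow_succ', ih]

theorem mul_pow_mul_comm {ι κ : Type*} [Fintype ι] [Fintype κ] [DecidableEq ι] [DecidableEq κ]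
    (M : Matrix ι κ ℂ) (N : Matrix κ ι ℂ) (m : ℕ) : M * (N * M) ^ m = (M * N) ^ m * M := by
  induction m with
  | zero => simp
  | succ m ih => rw [pow_succ, ← Matrix.mul_assoc, ih, pow_succ]; simp only [Matrix.mul_assoc]

theorem stmt1 {q n : ℕ} (A : Matrix (Fin q) (Fin n) ℂ) (W : Matrix (Fin n) (Fin q) ℂ)
    (hW : W ≠ 0) (m : ℕ) (hm : 0 < m)
    (Adag : Matrix (Fin n) (Fin q) ℂ) (hAdag : IsMP A Adag)
    (WAcep : Matrix (Fin n) (Fin n) ℂ) (hWAcep : IsCoreEP (W * A) WAcep)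
    (AepW AWGm : Matrix (Fin q) (Fin n) ℂ) (AWGMP : Matrix (Fin n) (Fin q) ℂ)
    (hAepW : AepW = A * (WAcep * WAcep))
    (hAWGm : AWGm = (AepW * W) ^ m * AepW * (W * A) ^ m)
    (hAWGMP : AWGMP = W * AWGm * W * A * Adag) :
    AWGMP * A * AWGMP = AWGMP := by
  have hBX := hWAcep.mul_mul_self
  obtain ⟨hA, -⟩ := hAdag
  obtain ⟨hX, -⟩ := hWAcep
  have hWep : W * AepW = WAcep := by
    rw [hAepW, ← Matrix.mul_assoc, ← Matrix.mul_assoc, hBX]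
  have hform : AWGMP = WAcep ^ (m + 1) * (W * A) ^ (m + 1) * Adag := by
    rw [hAWGMP, hAWGm]
    calc W * ((AepW * W) ^ m * AepW * (W * A) ^ m) * W * A * Adag
        = W * (AepW * W) ^ m * AepW * ((W * A) ^ m * (W * A)) * Adag := by
          simp only [Matrix.mul_assoc]
      _ = _ := by
          rw [mul_pow_mul_comm, Matrix.mul_assoc _ W, hWep, ← pow_succ, ← pow_succ]
  set B := W * A with hB
  set P := WAcep ^ (m + 1) * B ^ (m + 1) with hP
  have hPP : P * P = P := by
    calc P * P = WAcep ^ (m + 1) * (B ^ (m + 1) * WAcep ^ (m + 1)) * B ^ (m + 1) := by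
          simp only [hP, Matrix.mul_assoc]
      _ = WAcep ^ m * (WAcep * B * WAcep) * B ^ (m + 1) := by
          rw [pow_mul_pow_eq_mul hBX, pow_succ]
          simp only [Matrix.mul_assoc]
      _ = P := by rw [hX, ← pow_succ]
  have hPA : P * Adag * A = P := by
    calc P * Adag * A = WAcep ^ (m + 1) * (B ^ m * (W * (A * Adag * A))) := by
          rw [hP, pow_succ B, hB]
          simp only [Matrix.mul_assoc]
      _ = P := by rw [hA, ← hB, ← pow_succ]
  rw [hform, hPA, ← Matrix.mul_assoc, hPP]
end

section
/- Let A be a q×n complex matrix, W a nonzero n×q complex matrix, m a positive integer, k = max(Ind(AW), Ind(WA)), and t = rank((WA)^k). Suppose V and U^* are n×(n−t) complex matrices such that range(V) = null(((WA)^k)^*·(WA)^{m+1}) and null(U) = range((WA)^k), and suppose U·V is invertible; set E = V·(UV)^{-1}·U. Then the matrix (WA)^k·((WA)^k)^*·(WA)^{m+1} + E is nonsingular, and its inverse equals ((WA)^k·((WA)^k)^*·(WA)^{m+1})^# + E^#, where ^# denotes the group inverse. -/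
open Matrix

theorem mul_eq_zero_of_mrange_le_mker {ι κ l : Type*} [Fintype κ] [Fintype l]
    {M : Matrix ι κ ℂ} {N : Matrix κ l ℂ} (h : mrange N ≤ mker M) : M * N = 0 := by
  classical
  refine Matrix.ext_of_mulVec_single fun j => ?_
  have hj : N *ᵥ Pi.single j 1 ∈ mker M := h ⟨Pi.single j 1, rfl⟩
  rw [← mulVec_mulVec, zero_mulVec]
  exact hj

theorem exists_eq_mul_of_mul_eq_zero {ι κ l μ : Type*} [Fintype κ] [Fintype l] [Fintype μ]
    {M : Matrix ι κ ℂ} {V : Matrix κ l ℂ} {R : Matrix κ μ ℂ} (h : mker M ≤ mrange V)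
    (hR : M * R = 0) : ∃ Y : Matrix l μ ℂ, R = V * Y := by
  classical
  have hcol (j : μ) : ∃ y, V *ᵥ y = R *ᵥ Pi.single j 1 := by
    have hj : R *ᵥ Pi.single j 1 ∈ mker M := by
      change M *ᵥ (R *ᵥ Pi.single j 1) = 0
      rw [mulVec_mulVec, hR, zero_mulVec]
    exact h hj
  choose y hy using hcol
  refine ⟨Matrix.of fun i j => y j i, Matrix.ext_of_mulVec_single fun j => ?_⟩
  rw [← hy, ← mulVec_mulVec]
  congr 1
  ext i
  simp

theorem IsGroupInv.eq_self_of_idempotent {ι : Type*} [Fintype ι] {E X : Matrix ι ι ℂ}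
    (hX : IsGroupInv E X) (hE : E * E = E) : X = E := by
  obtain ⟨h₁, h₂, h₃⟩ := hX
  have hEX : E * X = E := by
    rw [← hE, Matrix.mul_assoc, h₃, ← Matrix.mul_assoc, h₁, hE]
  rw [← h₂, ← h₃, hEX, hEX]

theorem stmt17 {q n : ℕ} (A : Matrix (Fin q) (Fin n) ℂ) (W : Matrix (Fin n) (Fin q) ℂ)
    (hW : W ≠ 0) (m : ℕ) (hm : 0 < m) (k : ℕ)
    (hk : k = max (matInd (A * W)) (matInd (W * A)))
    (t : ℕ) (ht : ((W * A) ^ k).rank = t)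
    (V : Matrix (Fin n) (Fin (n - t)) ℂ) (U : Matrix (Fin (n - t)) (Fin n) ℂ)
    (hV : mrange V = mker (((W * A) ^ k)ᴴ * (W * A) ^ (m + 1)))
    (hU : mker U = mrange ((W * A) ^ k))
    (hUV : IsUnit (U * V).det)
    (E : Matrix (Fin n) (Fin n) ℂ) (hE : E = V * (U * V)⁻¹ * U)
    (Gsharp Esharp : Matrix (Fin n) (Fin n) ℂ)
    (hGsharp : IsGroupInv ((W * A) ^ k * ((W * A) ^ k)ᴴ * (W * A) ^ (m + 1)) Gsharp)
    (hEsharp : IsGroupInv E Esharp) :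
    IsUnit ((W * A) ^ k * ((W * A) ^ k)ᴴ * (W * A) ^ (m + 1) + E).det ∧
      ((W * A) ^ k * ((W * A) ^ k)ᴴ * (W * A) ^ (m + 1) + E)⁻¹ = Gsharp + Esharp := by
  set M := (W * A) ^ k
  set C := (W * A) ^ (m + 1)
  set G := M * Mᴴ * C with hG
  have hNV : Mᴴ * C * V = 0 := mul_eq_zero_of_mrange_le_mker hV.le
  have hUM : U * M = 0 := mul_eq_zero_of_mrange_le_mker hU.ge
  have hUE : U * E = U := by
    rw [hE, Matrix.mul_assoc V, ← Matrix.mul_assoc U, ← Matrix.mul_assoc,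
      mul_nonsing_inv _ hUV, Matrix.one_mul]
  have hEE : E * E = E := by
    nth_rw 1 [hE]
    rw [Matrix.mul_assoc, hUE, ← hE]
  have hGE : G * E = 0 := by
    calc G * E = M * (Mᴴ * C * V) * ((U * V)⁻¹ * U) := by simp only [hG, hE, Matrix.mul_assoc]
      _ = 0 := by rw [hNV, Matrix.mul_zero, Matrix.zero_mul]
  have hEG : E * G = 0 := by
    calc E * G = V * (U * V)⁻¹ * (U * M) * (Mᴴ * C) := by simp only [hG, hE, Matrix.mul_assoc]
      _ = 0 := by rw [hUM, Matrix.mul_zero, Matrix.zero_mul]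
  obtain rfl := hEsharp.eq_self_of_idempotent hEE
  obtain ⟨h₁, h₂, h₃⟩ := hGsharp
  have hR : 1 - G * Gsharp - Esharp = 0 := by
    have hGR : G * (1 - G * Gsharp - Esharp) = 0 := by
      rw [mul_sub, mul_sub, hGE, h₃, ← mul_assoc, h₁, mul_one, sub_self, sub_zero]
    have hUR : U * (1 - G * Gsharp - Esharp) = 0 := by
      have hUG : U * G = 0 := by
        rw [hG, Matrix.mul_assoc M, ← Matrix.mul_assoc, hUM, Matrix.zero_mul]
      rw [Matrix.mul_sub, Matrix.mul_sub, hUE, ← Matrix.mul_assoc, hUG, Matrix.zero_mul,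
        Matrix.mul_one, sub_zero, sub_self]
    have hNR : Mᴴ * C * (1 - G * Gsharp - Esharp) = 0 := by
      rw [Matrix.mul_assoc]
      open scoped ComplexOrder in
      exact (self_mul_conjTranspose_mul_eq_zero M _).mp
        (by simpa only [hG, Matrix.mul_assoc] using hGR)
    obtain ⟨Y, hY⟩ := exists_eq_mul_of_mul_eq_zero hV.ge hNR
    have hY0 : Y = 0 := by
      rw [← Matrix.one_mul Y, ← nonsing_inv_mul _ hUV, Matrix.mul_assoc, Matrix.mul_assoc U,
        ← hY, hUR, Matrix.mul_zero]
    rw [hY, hY0, Matrix.mul_zero]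
  have hEX : Esharp * Gsharp = 0 := by
    rw [← h₂, ← h₃, ← mul_assoc, ← mul_assoc, hEG, zero_mul, zero_mul]
  have hinv : (G + Esharp) * (Gsharp + Esharp) = 1 := by
    rw [add_mul, mul_add, mul_add, hGE, hEX, hEE, add_zero, zero_add]
    rw [sub_sub, sub_eq_zero] at hR
    exact hR.symm
  exact ⟨isUnit_det_of_right_inverse hinv, inv_eq_right_inv hinv⟩
end

section
/- Let A be a q×n complex matrix and W a nonzero n×q complex matrix, with A^{⊕,W} = A·((WA)^⊕)^2 where (WA)^⊕ is the core-EP inverse of WA. Then A·W·A^{⊕,W}·W·A^{⊕,W} = A^{⊕,W}, and consequently A^{⊕,W}·W·A·W·A·W·A^{⊕,W} = A·W·A^{⊕,W}. -/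
open Matrix

theorem mrange_le_iff_exists_mul {ι κ μ : Type*} [Fintype κ] [Fintype μ] [DecidableEq μ]
    {M : Matrix ι κ ℂ} {N : Matrix ι μ ℂ} : mrange N ≤ mrange M ↔ ∃ K : Matrix κ μ ℂ, N = M * K := by
  constructor
  · intro h
    have hcol (j : μ) : ∃ v : κ → ℂ, M *ᵥ v = N.col j := by
      have hj : N.col j ∈ mrange N := ⟨Pi.single j 1, by simp⟩
      exact h hj
    choose v hv using hcol
    refine ⟨Matrix.of fun i j => v j i, ?_⟩
    ext i j
    exact (congrFun (hv j) i).symm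
  · rintro ⟨K, rfl⟩
    rw [mrange, mulVecLin_mul]
    exact LinearMap.range_comp_le_range _ _

namespace IsCoreEP

variable {ι : Type*} [Fintype ι] [DecidableEq ι] {B X : Matrix ι ι ℂ}

theorem exists_mul_eq (h : IsCoreEP B X) : ∃ K : Matrix ι ι ℂ, B * X = X * K := by
  obtain ⟨-, hr, -⟩ := h
  obtain ⟨Y, hY⟩ := mrange_le_iff_exists_mul.1 hr.le
  obtain ⟨Z, hZ⟩ := mrange_le_iff_exists_mul.1 hr.ge
  refine ⟨Z * (B * Y), ?_⟩
  rw [← Matrix.mul_assoc X, ← hZ, ← Matrix.mul_assoc, ← pow_succ, pow_succ', Matrix.mul_assoc,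
    ← hY]

theorem mrange_mul_eq (h : IsCoreEP B X) : mrange (B * X) = mrange X := by
  refine Submodule.eq_of_le_of_finrank_le (mrange_le_iff_exists_mul.2 h.exists_mul_eq) ?_
  have hle : (X * (B * X)).rank ≤ (B * X).rank := rank_mul_le_right X (B * X)
  rwa [← Matrix.mul_assoc, h.1] at hle

theorem mul_mul_self_s19 (h : IsCoreEP B X) : B * X * X = X := by
  obtain ⟨L, hL⟩ := mrange_le_iff_exists_mul.1 h.mrange_mul_eq.ge
  calc B * X * X = B * X * (B * X * L) := by rw [← hL]
    _ = B * (X * B * X) * L := by simp only [Matrix.mul_assoc]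
    _ = X := by rw [h.1, ← hL]

theorem mul_mul_mul (h : IsCoreEP B X) : X * B * (B * X) = B * X := by
  obtain ⟨K, hK⟩ := h.exists_mul_eq
  rw [hK, ← Matrix.mul_assoc, h.1]

end IsCoreEP

theorem stmt19 {q n : ℕ} (A : Matrix (Fin q) (Fin n) ℂ) (W : Matrix (Fin n) (Fin q) ℂ)
    (hW : W ≠ 0)
    (WAcep : Matrix (Fin n) (Fin n) ℂ) (hWAcep : IsCoreEP (W * A) WAcep)
    (AepW : Matrix (Fin q) (Fin n) ℂ)
    (hAepW : AepW = A * (WAcep * WAcep)) :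
    A * W * AepW * W * AepW = AepW ∧
      AepW * W * A * W * A * W * AepW = A * W * AepW := by
  subst hAepW
  have hX := hWAcep.1
  have hXX := hWAcep.mul_mul_self_s19
  have hBX := hWAcep.mul_mul_mul
  constructor
  · calc A * W * (A * (WAcep * WAcep)) * W * (A * (WAcep * WAcep))
        = A * (W * A * WAcep * (WAcep * (W * A) * WAcep) * WAcep) := by
          simp only [Matrix.mul_assoc]
      _ = A * (WAcep * WAcep) := by rw [hX, hXX]
  · calc A * (WAcep * WAcep) * W * A * W * A * W * (A * (WAcep * WAcep))
        = A * (WAcep * (WAcep * (W * A) * (W * A * (W * A * WAcep * WAcep)))) := by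
          simp only [Matrix.mul_assoc]
      _ = A * (WAcep * (W * A) * WAcep) := by rw [hXX, hBX, Matrix.mul_assoc WAcep]
      _ = A * (W * A * WAcep * WAcep) := by rw [hX, hXX]
      _ = A * W * (A * (WAcep * WAcep)) := by simp only [Matrix.mul_assoc]
end
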